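/- arXiv:1911.12444 — 2 statements merged into one kernel-verified Lean document; each statement's English description precedes it below -/
import Mathlib

section
/- For any vectors a_j, b_j ∈ ℝ^N (j = 1,…,d) and any nonempty u ⊆ {1,…,d}, the function h₀ : ℝ^d → ℝ^N whose i-th component is h₀^{(i)}(x) := ∏_{j∉u} (a_j^{(i)} F_j(x_j) + b_j^{(i)}) · ∏_{j∈u} (a_j^{(i)} F_j(x_j) − a_j^{(i)}/2) attains equality in the derivative-based variance inequality: Var(h₀) = (1/2^{|u|}) ∫_Ω (∂^{|u|}h₀/∂x_u)(x) (∂^{|u|}h₀/∂x_u)(x)^T ∏_{k∈u} F_k(x_k)(1 − F_k(x_k))/ρ_k(x_k)² dμ(x). -/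
open MeasureTheory Finset
open scoped Classical

noncomputable section

variable {d N : ℕ}

/-- The indicator `1[a ≥ b]`. -/
def ind (a b : ℝ) : ℝ := if b ≤ a then 1 else 0

/-- The point of `ℝ^d` whose coordinates in `v` come from `x'` and whose remaining
coordinates come from `x`; i.e. `(x'_v, x_{∼v})`. -/
def combine (v : Finset (Fin d)) (x' x : Fin d → ℝ) : Fin d → ℝ :=
  fun j => if j ∈ v then x' j else x j

/-- The weight kernel `∏_{j∈v} (F_j(x'_j) − 1[x'_j ≥ x_j]) / ρ_j(x'_j)`. -/
def wker (F ρ : Fin d → ℝ → ℝ) (v : Finset (Fin d)) (x' x : Fin d → ℝ) : ℝ :=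
  ∏ j ∈ v, (F j (x' j) - ind (x' j) (x j)) / ρ j (x' j)

/-- The covariance kernel
`∏_{k∈v} (F_k(min(x_k,x'_k)) − F_k(x_k) F_k(x'_k)) / (ρ_k(x_k) ρ_k(x'_k))`. -/
def covker (F ρ : Fin d → ℝ → ℝ) (v : Finset (Fin d)) (x x' : Fin d → ℝ) : ℝ :=
  ∏ k ∈ v, (F k (min (x k) (x' k)) - F k (x k) * F k (x' k)) / (ρ k (x k) * ρ k (x' k))

/-- The matrix variance `Var(h) = ∫ h hᵀ dπ − (∫ h dπ)(∫ h dπ)ᵀ`, entrywise. -/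
def mVar (π : Measure (Fin d → ℝ)) (h : (Fin d → ℝ) → (Fin N → ℝ)) :
    Matrix (Fin N) (Fin N) ℝ :=
  Matrix.of fun i k => (∫ x, h x i * h x k ∂π) - (∫ x, h x i ∂π) * (∫ x, h x k ∂π)

/-- `Df` is a coherent family of iterated cross-partial derivatives on `Ω`:
`Df (insert j v)` is the partial derivative of `Df v` in the `j`-th coordinate. -/
def CrossDerivChain (Ω : Fin d → Set ℝ)
    (Df : Finset (Fin d) → (Fin d → ℝ) → (Fin N → ℝ)) : Prop :=
  ∀ (v : Finset (Fin d)) (j : Fin d), j ∉ v → ∀ x : Fin d → ℝ, (∀ k, x k ∈ Ω k) →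
    HasDerivAt (fun t => Df v (Function.update x j t)) (Df (insert j v) x) (x j)

/-- The derivative-based component
`g_v(x) = ∫_{Ω_v} (∂^{|v|}f/∂x_v)(x'_v, x_{∼v}) ∏_{j∈v} (F_j(x'_j) − 1[x'_j ≥ x_j])/ρ_j(x'_j) dμ(x'_v)`. -/
def gcomp (μ : Fin d → Measure ℝ) (F ρ : Fin d → ℝ → ℝ)
    (Df : Finset (Fin d) → (Fin d → ℝ) → (Fin N → ℝ))
    (v : Finset (Fin d)) (x : Fin d → ℝ) : Fin N → ℝ :=
  ∫ x', wker F ρ v x' x • Df v (combine v x' x) ∂(Measure.pi μ)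

end


/-- `Dg` is a coherent family of iterated cross-partial derivatives on `Ω`,
along coordinates in `u` only. -/
def CrossDerivChainOn (Ω : Fin d → Set ℝ) (u : Finset (Fin d))
    (Dg : Finset (Fin d) → (Fin d → ℝ) → (Fin N → ℝ)) : Prop :=
  ∀ v ⊆ u, ∀ j ∈ u, j ∉ v → ∀ x : Fin d → ℝ, (∀ k, x k ∈ Ω k) →
    HasDerivAt (fun t => Dg v (Function.update x j t)) (Dg (insert j v) x) (x j)

noncomputable section

/-- Fubini on the triangle `{(s, t) | s ≤ t}` for a bounded measurable integrand. -/
theorem integral_setIntegral_Iic_eq (ν : Measure ℝ) [IsFiniteMeasure ν] (f : ℝ → ℝ)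
    (hf : Measurable f) (C : ℝ) (hC : ∀ s, |f s| ≤ C) :
    ∫ t, (∫ s in Set.Iic t, f s ∂ν) ∂ν = ∫ s, f s * ν.real (Set.Ici s) ∂ν := by
  have hint : Integrable
      (Function.uncurry fun t s : ℝ => (Set.Iic t).indicator f s) (ν.prod ν) := by
    have heq : (Function.uncurry fun t s : ℝ => (Set.Iic t).indicator f s)
        = {p : ℝ × ℝ | p.2 ≤ p.1}.indicator fun p => f p.2 := by
      ext ⟨t, s⟩
      simp [Set.indicator]
    rw [heq]
    refine Integrable.indicator ?_ (measurableSet_le measurable_snd measurable_fst)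
    exact Integrable.of_bound (hf.comp measurable_snd).aestronglyMeasurable C
      (Filter.Eventually.of_forall fun p => hC p.2)
  calc ∫ t, (∫ s in Set.Iic t, f s ∂ν) ∂ν
      = ∫ t, (∫ s, (Set.Iic t).indicator f s ∂ν) ∂ν := by
        simp_rw [integral_indicator measurableSet_Iic]
    _ = ∫ s, (∫ t, (Set.Iic t).indicator f s ∂ν) ∂ν := integral_integral_swap hint
    _ = ∫ s, f s * ν.real (Set.Ici s) ∂ν := by
        congr 1 with s
        have heq : (fun t => (Set.Iic t).indicator f s)
            = (Set.Ici s).indicator fun _ => f s := by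
          ext t
          simp [Set.indicator]
        rw [heq, integral_indicator measurableSet_Ici, setIntegral_const, smul_eq_mul, mul_comm]

theorem measurable_measureReal_Iic (ν : Measure ℝ) [IsFiniteMeasure ν] :
    Measurable fun t => ν.real (Set.Iic t) :=
  Monotone.measurable fun _ _ h => measureReal_mono (Set.Iic_subset_Iic.2 h)

theorem integrable_measureReal_Iic_pow (ν : Measure ℝ) [IsFiniteMeasure ν] (n : ℕ) :
    Integrable (fun t => ν.real (Set.Iic t) ^ n) ν := by
  refine Integrable.of_bound ((measurable_measureReal_Iic ν).pow_const n).aestronglyMeasurable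
    (ν.real Set.univ ^ n) (Filter.Eventually.of_forall fun t => ?_)
  rw [Real.norm_of_nonneg (by positivity)]
  exact pow_le_pow_left₀ measureReal_nonneg (measureReal_mono (Set.subset_univ _)) n

theorem measureReal_Ici_eq_sub (ν : Measure ℝ) [IsFiniteMeasure ν] [NullSingletonClass ν] (s : ℝ) :
    ν.real (Set.Ici s) = ν.real Set.univ - ν.real (Set.Iic s) := by
  rw [← Set.compl_Iio, measureReal_compl measurableSet_Iio,
    measureReal_congr (Iio_ae_eq_Iic (μ := ν) (a := s))]

theorem integral_measureReal_Iic (ν : Measure ℝ) [IsFiniteMeasure ν] [NullSingletonClass ν] :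
    ∫ t, ν.real (Set.Iic t) ∂ν = ν.real Set.univ ^ 2 / 2 := by
  have h := integral_setIntegral_Iic_eq ν (fun _ => 1) measurable_const 1 (by simp)
  have hi := integrable_measureReal_Iic_pow ν 1
  simp only [pow_one] at hi
  simp only [setIntegral_const, smul_eq_mul, mul_one, one_mul, measureReal_Ici_eq_sub] at h
  rw [integral_sub (integrable_const _) hi, integral_const, smul_eq_mul] at h
  linarith

theorem setIntegral_Iic_measureReal_Iic (ν : Measure ℝ) [IsFiniteMeasure ν] [NullSingletonClass ν] (t : ℝ) :
    ∫ s in Set.Iic t, ν.real (Set.Iic s) ∂ν = ν.real (Set.Iic t) ^ 2 / 2 := by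
  have h := integral_measureReal_Iic (ν.restrict (Set.Iic t))
  rw [measureReal_restrict_apply_univ] at h
  rw [← h]
  refine setIntegral_congr_fun measurableSet_Iic fun s hs => ?_
  rw [measureReal_restrict_apply measurableSet_Iic,
    Set.inter_eq_left.2 (Set.Iic_subset_Iic.2 hs)]

theorem integral_measureReal_Iic_sq (ν : Measure ℝ) [IsProbabilityMeasure ν] [NullSingletonClass ν] :
    ∫ t, ν.real (Set.Iic t) ^ 2 ∂ν = 1 / 3 := by
  have h := integral_setIntegral_Iic_eq ν (fun s => ν.real (Set.Iic s))
    (measurable_measureReal_Iic ν) 1 fun s => by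
      rw [abs_of_nonneg measureReal_nonneg]
      exact measureReal_le_one
  have hi := integrable_measureReal_Iic_pow ν 1
  simp only [pow_one] at hi
  have h1 := integral_measureReal_Iic ν
  simp only [setIntegral_Iic_measureReal_Iic, measureReal_Ici_eq_sub, probReal_univ, mul_sub,
    mul_one, ← sq, integral_div] at h h1
  rw [integral_sub hi (integrable_measureReal_Iic_pow ν 2), h1] at h
  linarith

theorem measurable_of_continuousOn_of_eq_zero {ρ : ℝ → ℝ} {s : Set ℝ} (hs : IsOpen s)
    (hcont : ContinuousOn ρ s) (hzero : ∀ t ∉ s, ρ t = 0) : Measurable ρ := by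
  have h := hcont.measurable_piecewise (g := fun _ => 0) continuousOn_const hs.measurableSet
  convert h using 1
  ext t
  by_cases ht : t ∈ s
  · simp [ht]
  · simp [ht, hzero t ht]

/-- The distribution function is differentiable wherever the density is continuous. -/
theorem hasDerivAt_measureReal_Iic_of_withDensity {ν : Measure ℝ} [IsProbabilityMeasure ν]
    {ρ : ℝ → ℝ} (hdens : ν = volume.withDensity fun t => ENNReal.ofReal (ρ t))
    (hmeas : Measurable ρ) (hnn : ∀ t, 0 ≤ ρ t) {t : ℝ} (hcont : ContinuousAt ρ t) :
    HasDerivAt (fun s => ν.real (Set.Iic s)) (ρ t) t := by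
  have hint : Integrable ρ := by
    refine ⟨hmeas.aestronglyMeasurable, ?_⟩
    rw [hasFiniteIntegral_iff_ofReal (Filter.Eventually.of_forall hnn),
      ← setLIntegral_univ, ← withDensity_apply _ MeasurableSet.univ, ← hdens]
    exact measure_lt_top _ _
  have hF : ∀ s, ν.real (Set.Iic s) = ∫ r in Set.Iic s, ρ r := fun s => by
    rw [integral_eq_lintegral_of_nonneg_ae (Filter.Eventually.of_forall hnn)
      hmeas.aestronglyMeasurable, ← withDensity_apply _ measurableSet_Iic, ← hdens]
    rfl
  have heq : (fun s => ν.real (Set.Iic s))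
      = fun s => (∫ r in t..s, ρ r) + ∫ r in Set.Iic t, ρ r := by
    ext s
    rw [hF, ← intervalIntegral.integral_Iic_sub_Iic hint.integrableOn hint.integrableOn]
    ring
  rw [heq]
  exact (intervalIntegral.integral_hasDerivAt_right hint.intervalIntegrable
    hmeas.stronglyMeasurable.stronglyMeasurableAtFilter hcont).add_const _

/-- A chain of cross-partial derivatives of a product of functions of one coordinate each is
obtained by differentiating the corresponding factors. -/
theorem CrossDerivChainOn.eq_prod {d N : ℕ} {Ω : Fin d → Set ℝ} (hΩopen : ∀ j, IsOpen (Ω j))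
    {u : Finset (Fin d)} {Dg : Finset (Fin d) → (Fin d → ℝ) → (Fin N → ℝ)}
    (hD : CrossDerivChainOn Ω u Dg) {i : Fin N} {φ ψ : Fin d → ℝ → ℝ}
    (hφ : ∀ j ∈ u, ∀ t ∈ Ω j, HasDerivAt (φ j) (ψ j t) t)
    (h0 : ∀ x, Dg ∅ x i = ∏ j, φ j (x j)) (v : Finset (Fin d)) (hv : v ⊆ u)
    (x : Fin d → ℝ) (hx : ∀ k, x k ∈ Ω k) :
    Dg v x i = ∏ j, if j ∈ v then ψ j (x j) else φ j (x j) := by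
  induction v using Finset.induction_on generalizing x with
  | empty => simpa using h0 x
  | insert j v hj ih =>
    have hju : j ∈ u := hv (mem_insert_self j v)
    have hvu : v ⊆ u := (subset_insert j v).trans hv
    have hderiv := hasDerivAt_pi.1 (hD v hvu j hju hj x hx) i
    have hderiv' : HasDerivAt (fun t => φ j t *
        ∏ k ∈ univ.erase j, if k ∈ v then ψ k (x k) else φ k (x k))
        (ψ j (x j) * ∏ k ∈ univ.erase j, if k ∈ v then ψ k (x k) else φ k (x k)) (x j) :=
      (hφ j hju (x j) (hx j)).mul_const _
    have heq : (fun t => Dg v (Function.update x j t) i) =ᶠ[nhds (x j)] fun t => φ j t *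
        ∏ k ∈ univ.erase j, if k ∈ v then ψ k (x k) else φ k (x k) := by
      filter_upwards [(hΩopen j).mem_nhds (hx j)] with t ht
      rw [ih hvu (Function.update x j t) fun k => ?_]
      · rw [← mul_prod_erase univ _ (mem_univ j)]
        simp only [hj, if_false, Function.update_self]
        congr 1
        refine prod_congr rfl fun k hk => ?_
        rw [Function.update_of_ne (ne_of_mem_erase hk)]
      · rcases eq_or_ne k j with rfl | hk
        · simpa using ht
        · simpa [Function.update_of_ne hk] using hx k
    rw [hderiv.unique (hderiv'.congr_of_eventuallyEq heq), ← mul_prod_erase univ _ (mem_univ j),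
      if_pos (mem_insert_self j v)]
    congr 1
    refine prod_congr rfl fun k hk => ?_
    simp [ne_of_mem_erase hk]

theorem equality_case_variance_inequality
    {d N : ℕ} (hd : 0 < d) (hN : 0 < N)
    (μ : Fin d → Measure ℝ) [∀ j, IsProbabilityMeasure (μ j)]
    (Ω : Fin d → Set ℝ) (hΩopen : ∀ j, IsOpen (Ω j))
    (ρ F : Fin d → ℝ → ℝ)
    (hdens : ∀ j, μ j = volume.withDensity fun t => ENNReal.ofReal (ρ j t))
    (hρcont : ∀ j, ContinuousOn (ρ j) (Ω j))
    (hρpos : ∀ j, ∀ t ∈ Ω j, 0 < ρ j t)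
    (hρzero : ∀ j, ∀ t ∉ Ω j, ρ j t = 0)
    (hFdef : ∀ j t, F j t = ((μ j) (Set.Iic t)).toReal)
    (u : Finset (Fin d)) (hu : u.Nonempty) (a b : Fin d → Fin N → ℝ)
    (h₀ : (Fin d → ℝ) → (Fin N → ℝ))
    (hh₀ : ∀ x i, h₀ x i =
      (∏ j ∈ uᶜ, (a j i * F j (x j) + b j i)) * ∏ j ∈ u, (a j i * F j (x j) - a j i / 2))
    (Dh : Finset (Fin d) → (Fin d → ℝ) → (Fin N → ℝ))
    (hDh0 : Dh ∅ = h₀) (hDhchain : CrossDerivChainOn Ω u Dh) :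
    mVar (Measure.pi μ) h₀ =
      ((1 : ℝ) / 2 ^ u.card) • Matrix.of fun i k =>
        ∫ x, Dh u x i * Dh u x k *
          ∏ j ∈ u, (F j (x j) * (1 - F j (x j)) / (ρ j (x j)) ^ 2) ∂(Measure.pi μ) := by
  have hFr : ∀ j, F j = fun t => (μ j).real (Set.Iic t) := fun j => funext (hFdef j)
  have hatoms : ∀ j, NullSingletonClass (μ j) := fun j => by
    rw [hdens j]
    infer_instance
  have hnn : ∀ j t, 0 ≤ ρ j t := fun j t => by
    by_cases ht : t ∈ Ω j
    · exact (hρpos j t ht).le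
    · exact (hρzero j t ht).ge
  have hmeas : ∀ j, Measurable (ρ j) := fun j =>
    measurable_of_continuousOn_of_eq_zero (hΩopen j) (hρcont j) (hρzero j)
  have hFderiv : ∀ j, ∀ t ∈ Ω j, HasDerivAt (F j) (ρ j t) t := fun j t ht => by
    rw [hFr j]
    exact hasDerivAt_measureReal_Iic_of_withDensity (hdens j) (hmeas j) (hnn j)
      ((hρcont j).continuousAt ((hΩopen j).mem_nhds ht))
  have hF1 : ∀ j, Integrable (F j) (μ j) := fun j => by
    simpa [hFr j] using integrable_measureReal_Iic_pow (μ j) 1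
  have hF2 : ∀ j, Integrable (fun t => F j t ^ 2) (μ j) := fun j => by
    simpa [hFr j] using integrable_measureReal_Iic_pow (μ j) 2
  have hE1 : ∀ j, ∫ t, F j t ∂(μ j) = 1 / 2 := fun j => by
    simpa [hFr j] using integral_measureReal_Iic (μ j)
  have hE2 : ∀ j, ∫ t, F j t ^ 2 ∂(μ j) = 1 / 3 := fun j => by
    simpa [hFr j] using integral_measureReal_Iic_sq (μ j)
  have hΩae : ∀ᵐ x ∂(Measure.pi μ), ∀ j, x j ∈ Ω j := by
    rw [ae_all_iff]
    intro j
    refine (Measure.tendsto_eval_ae_ae (μ := μ) (i := j)).eventually (p := fun t => t ∈ Ω j) ?_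
    rw [hdens j, ae_withDensity_iff (hmeas j).ennreal_ofReal]
    refine Filter.Eventually.of_forall fun t ht => ?_
    by_contra hc
    exact ht (by simp [hρzero j t hc])
  set φ : Fin N → Fin d → ℝ → ℝ := fun i j t =>
    if j ∈ u then a j i * F j t - a j i / 2 else a j i * F j t + b j i with hφdef
  have hsplit : ∀ f g : Fin d → ℝ,
      (∏ j, if j ∈ u then f j else g j) = (∏ j ∈ uᶜ, g j) * ∏ j ∈ u, f j := fun f g => by
    rw [← prod_compl_mul_prod u]
    congr 1
    · exact prod_congr rfl fun j hj => if_neg (mem_compl.1 hj)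
    · exact prod_congr rfl fun j hj => if_pos hj
  have hprod : ∀ x i, h₀ x i = ∏ j, φ i j (x j) := fun x i => by
    rw [hh₀, ← hsplit]
  have hDu : ∀ i x, (∀ j, x j ∈ Ω j) →
      Dh u x i = ∏ j, if j ∈ u then a j i * ρ j (x j) else φ i j (x j) := fun i x hx => by
    refine hDhchain.eq_prod hΩopen (φ := φ i) (ψ := fun j t => a j i * ρ j t) ?_ ?_ u
      subset_rfl x hx
    · intro j hj t ht
      simp only [hφdef, hj, if_true]
      exact ((hFderiv j t ht).const_mul _).sub_const _
    · intro x
      rw [hDh0, hprod]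
  have hmean : ∀ i, ∫ x, h₀ x i ∂(Measure.pi μ) = 0 := fun i => by
    simp_rw [hprod]
    rw [integral_fintype_prod_eq_prod]
    obtain ⟨j, hj⟩ := hu
    refine prod_eq_zero (mem_univ j) ?_
    simp only [hφdef, hj, if_true]
    rw [integral_sub ((hF1 j).const_mul _) (integrable_const _), integral_const_mul, hE1]
    simp
    ring
  have hfactor : ∀ j i k, ∫ t, (a j i * F j t - a j i / 2) * (a j k * F j t - a j k / 2) ∂(μ j)
      = 1 / 2 * ∫ t, a j i * a j k * (F j t * (1 - F j t)) ∂(μ j) := fun j i k => by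
    have h1 : ∀ t, (a j i * F j t - a j i / 2) * (a j k * F j t - a j k / 2)
        = a j i * a j k * (F j t ^ 2 - F j t + 1 / 4) := fun t => by ring
    have h2 : ∀ t, F j t * (1 - F j t) = F j t - F j t ^ 2 := fun t => by ring
    simp_rw [h1, h2]
    rw [integral_const_mul, integral_const_mul, integral_add
      (f := fun t => F j t ^ 2 - F j t) ((hF2 j).sub (hF1 j)) (integrable_const _),
      integral_sub (hF2 j) (hF1 j), integral_sub (hF1 j) (hF2 j), hE1, hE2]
    simp
    ring
  ext i k
  simp only [mVar, Matrix.of_apply, Matrix.smul_apply, smul_eq_mul, hmean, mul_zero, sub_zero]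
  have hR : ∫ x, Dh u x i * Dh u x k *
        ∏ j ∈ u, (F j (x j) * (1 - F j (x j)) / (ρ j (x j)) ^ 2) ∂(Measure.pi μ)
      = ∏ j, ∫ t, (if j ∈ u then a j i * a j k * (F j t * (1 - F j t))
          else φ i j t * φ k j t) ∂(μ j) := by
    rw [← integral_fintype_prod_eq_prod (f := fun j t =>
      if j ∈ u then a j i * a j k * (F j t * (1 - F j t)) else φ i j t * φ k j t)]
    refine integral_congr_ae ?_
    filter_upwards [hΩae] with x hx
    rw [hDu i x hx, hDu k x hx, hsplit, hsplit, hsplit, prod_mul_distrib (s := uᶜ),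
      mul_mul_mul_comm, mul_assoc, ← prod_mul_distrib (s := u), ← prod_mul_distrib (s := u)]
    congr 1
    refine prod_congr rfl fun j _ => ?_
    have := (hρpos j (x j) (hx j)).ne'
    field_simp
  rw [hR]
  simp_rw [hprod, ← prod_mul_distrib]
  rw [integral_fintype_prod_eq_prod (f := fun j t => φ i j t * φ k j t)]
  have hhalf : (1 : ℝ) / 2 ^ u.card = ∏ j : Fin d, if j ∈ u then 1 / 2 else 1 := by
    rw [hsplit]
    simp
  rw [hhalf, ← prod_mul_distrib]
  refine prod_congr rfl fun j _ => ?_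
  by_cases hj : j ∈ u
  · simp only [hφdef, hj, if_true]
    exact hfactor j i k
  · simp [hj]

end
end

section
/- For every j ∈ {1,…,d}, the non-normalized total Sobol index Σ_j^tot := E[Var(f(X) | X_{∼j})] equals (a_j²/12) ∏_{i≠j} E[g_i(X_i)²], and the derivative-based upper bound NUB_j := (1/2) E[(∂f/∂x_j)(X)² · F_j(X_j)(1 − F_j(X_j))/ρ_j(X_j)²] satisfies NUB_j = Σ_j^tot; that is, the derivative-based proxy-measure coincides exactly with the total sensitivity index for this class of functions. -/
open MeasureTheory Finset
open scoped Classical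

noncomputable section

section Lemmas

open ProbabilityTheory Filter Topology

/-- The cdf of a real probability measure without atoms is continuous. -/
lemma continuous_cdf_of_nullSingleton (ν : Measure ℝ) [IsProbabilityMeasure ν]
    [NullSingletonClass ν] : Continuous (cdf ν) := by
  refine continuous_iff_continuousAt.2 fun t => ?_
  rw [(monotone_cdf ν).continuousAt_iff_leftLim_eq_rightLim, StieltjesFunction.rightLim_eq]
  have h : (cdf ν).measure {t} = 0 := by rw [measure_cdf]; exact measure_singleton t
  rw [StieltjesFunction.measure_singleton, ENNReal.ofReal_eq_zero] at h
  exact le_antisymm ((monotone_cdf ν).leftLim_le le_rfl) (by linarith)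

/-- Probability integral transform: a continuous cdf pushes its measure forward to the uniform
distribution on the unit interval. -/
lemma map_cdf_eq_uniform (ν : Measure ℝ) [IsProbabilityMeasure ν] [NullSingletonClass ν] :
    ν.map (cdf ν) = volume.restrict (Set.Icc 0 1) := by
  have hc := continuous_cdf_of_nullSingleton ν
  have hprob : IsProbabilityMeasure (ν.map (cdf ν)) :=
    Measure.isProbabilityMeasure_map hc.measurable.aemeasurable
  have hIic : ∀ s : ℝ, 0 < s → s < 1 → ν (cdf ν ⁻¹' Set.Iic s) = ENNReal.ofReal s := by
    intro s hs0 hs1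
    obtain ⟨u, hu⟩ := ((tendsto_cdf_atBot ν).eventually (gt_mem_nhds hs0)).exists
    obtain ⟨v, hv⟩ := ((tendsto_cdf_atTop ν).eventually (lt_mem_nhds hs1)).exists
    have hbdd : BddAbove (cdf ν ⁻¹' Set.Iic s) :=
      ⟨v, fun t ht => le_of_not_gt fun hvt =>
        absurd ((monotone_cdf ν) hvt.le) (not_le.2 (lt_of_le_of_lt ht hv))⟩
    have hmem := (isClosed_Iic.preimage hc).csSup_mem ⟨u, hu.le⟩ hbdd
    set c := sSup (cdf ν ⁻¹' Set.Iic s)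
    have hset : cdf ν ⁻¹' Set.Iic s = Set.Iic c :=
      Set.Subset.antisymm (fun t ht => le_csSup hbdd ht)
        fun t ht => ((monotone_cdf ν) ht).trans hmem
    have hcs : cdf ν c = s := by
      obtain ⟨w, hw⟩ := mem_range_of_exists_le_of_exists_ge hc ⟨u, hu.le⟩ ⟨v, hv.le⟩
      have hwc : w ≤ c := le_csSup hbdd (show cdf ν w ≤ s from hw.le)
      exact le_antisymm hmem (hw ▸ (monotone_cdf ν) hwc)
    rw [hset, ← ofReal_cdf, hcs]
  refine Measure.ext_of_Iic _ _ fun s => ?_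
  rw [Measure.map_apply hc.measurable measurableSet_Iic, Measure.restrict_apply measurableSet_Iic]
  rcases le_or_gt 1 s with h1 | h1
  · have h : cdf ν ⁻¹' Set.Iic s = Set.univ :=
      Set.eq_univ_of_forall fun t => (cdf_le_one ν t).trans h1
    have h' : Set.Iic s ∩ Set.Icc (0 : ℝ) 1 = Set.Icc 0 1 :=
      Set.inter_eq_right.2 fun t ht => ht.2.trans h1
    simp [h, h']
  · have h' : Set.Iic s ∩ Set.Icc (0 : ℝ) 1 = Set.Icc 0 s := by
      ext t; simp only [Set.mem_inter_iff, Set.mem_Iic, Set.mem_Icc]; grind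
    rw [h', Real.volume_Icc, sub_zero]
    rcases lt_or_ge 0 s with h0 | h0
    · exact hIic s h0 h1
    · rw [ENNReal.ofReal_of_nonpos h0, ← nonpos_iff_eq_zero]
      refine le_of_forall_gt_imp_ge_of_dense fun ε hε => ?_
      obtain ⟨δ, hδ0, hδε⟩ := ENNReal.lt_iff_exists_nnreal_btwn.1 hε
      have hδ : (0 : ℝ) < min δ (1 / 2) := by
        have : (0 : ℝ) < δ := by exact_mod_cast hδ0
        exact lt_min this (by norm_num)
      calc ν (cdf ν ⁻¹' Set.Iic s)
          ≤ ν (cdf ν ⁻¹' Set.Iic (min δ (1 / 2))) :=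
            measure_mono (Set.preimage_mono (Set.Iic_subset_Iic.2 (h0.trans hδ.le)))
        _ = ENNReal.ofReal (min δ (1 / 2)) :=
            hIic _ hδ (lt_of_le_of_lt (min_le_right _ _) (by norm_num))
        _ ≤ ENNReal.ofReal δ := ENNReal.ofReal_le_ofReal (min_le_left _ _)
        _ ≤ ε := by rw [ENNReal.ofReal_coe_nnreal]; exact hδε.le

/-- Integrals of functions of a continuous cdf are integrals over the unit interval. -/
lemma integral_comp_cdf (ν : Measure ℝ) [IsProbabilityMeasure ν] [NullSingletonClass ν]
    {φ : ℝ → ℝ} (hφ : Continuous φ) :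
    ∫ t, φ (cdf ν t) ∂ν = ∫ u in (0 : ℝ)..1, φ u := by
  rw [← integral_map (continuous_cdf_of_nullSingleton ν).measurable.aemeasurable
    hφ.aestronglyMeasurable, map_cdf_eq_uniform, integral_Icc_eq_integral_Ioc,
    intervalIntegral.integral_of_le zero_le_one]

/-- The second moment of an affine function of the cdf. -/
lemma integral_affine_cdf_sq (ν : Measure ℝ) [IsProbabilityMeasure ν] [NullSingletonClass ν]
    (α β : ℝ) : ∫ t, (α * cdf ν t + β) ^ 2 ∂ν = α ^ 2 / 3 + α * β + β ^ 2 := by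
  rw [integral_comp_cdf ν (φ := fun u => (α * u + β) ^ 2) (by fun_prop)]
  have h : ∀ u ∈ Set.uIcc (0 : ℝ) 1, HasDerivAt
      (fun u => α ^ 2 / 3 * u ^ 3 + α * β * u ^ 2 + β ^ 2 * u) ((α * u + β) ^ 2) u := fun u _ => by
    convert! (((hasDerivAt_pow 3 u).const_mul (α ^ 2 / 3)).add
      ((hasDerivAt_pow 2 u).const_mul (α * β))).add ((hasDerivAt_id u).const_mul (β ^ 2)) using 1
    push_cast; ring
  rw [intervalIntegral.integral_eq_sub_of_hasDerivAt h
    ((by fun_prop : Continuous fun u : ℝ => (α * u + β) ^ 2).intervalIntegrable _ _)]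
  ring

/-- The mean of an affine function of the cdf. -/
lemma integral_affine_cdf (ν : Measure ℝ) [IsProbabilityMeasure ν] [NullSingletonClass ν]
    (α β : ℝ) : ∫ t, (α * cdf ν t + β) ∂ν = α / 2 + β := by
  rw [integral_comp_cdf ν (φ := fun u => α * u + β) (by fun_prop)]
  have h : ∀ u ∈ Set.uIcc (0 : ℝ) 1, HasDerivAt
      (fun u => α / 2 * u ^ 2 + β * u) (α * u + β) u := fun u _ => by
    convert! ((hasDerivAt_pow 2 u).const_mul (α / 2)).add ((hasDerivAt_id u).const_mul β) using 1
    push_cast; ring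
  rw [intervalIntegral.integral_eq_sub_of_hasDerivAt h
    ((by fun_prop : Continuous fun u : ℝ => α * u + β).intervalIntegrable _ _)]
  ring

/-- The mean of `F (1 - F)` for a continuous cdf `F`. -/
lemma integral_cdf_mul_one_sub (ν : Measure ℝ) [IsProbabilityMeasure ν] [NullSingletonClass ν] :
    ∫ t, cdf ν t * (1 - cdf ν t) ∂ν = 1 / 6 := by
  rw [integral_comp_cdf ν (φ := fun u => u * (1 - u)) (by fun_prop)]
  have h : ∀ u ∈ Set.uIcc (0 : ℝ) 1, HasDerivAt
      (fun u => 1 / 2 * u ^ 2 - 1 / 3 * u ^ 3) (u * (1 - u)) u := fun u _ => by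
    convert! ((hasDerivAt_pow 2 u).const_mul (1 / 2)).sub
      ((hasDerivAt_pow 3 u).const_mul (1 / 3)) using 1
    push_cast; ring
  rw [intervalIntegral.integral_eq_sub_of_hasDerivAt h
    ((by fun_prop : Continuous fun u : ℝ => u * (1 - u)).intervalIntegrable _ _)]
  norm_num

/-- The cdf is differentiable wherever the density is continuous, with derivative the density. -/
lemma hasDerivAt_cdf_of_density {ν : Measure ℝ} [IsProbabilityMeasure ν] {Ω : Set ℝ}
    {r : ℝ → ℝ} (hΩ : IsOpen Ω) (hν : ν = volume.withDensity fun t => ENNReal.ofReal (r t))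
    (hcont : ContinuousOn r Ω) (hpos : ∀ t ∈ Ω, 0 < r t) (hzero : ∀ t ∉ Ω, r t = 0)
    {t : ℝ} (ht : t ∈ Ω) : HasDerivAt (cdf ν) (r t) t := by
  have hnonneg : ∀ u, 0 ≤ r u := fun u => by
    by_cases hu : u ∈ Ω
    · exact (hpos u hu).le
    · exact (hzero u hu).ge
  have hmeas : AEStronglyMeasurable r volume := by
    have hind : Ω.indicator r = r := Set.indicator_eq_self.2 fun u hu => by
      by_contra h
      exact hu (hzero u h)
    rw [← hind, aestronglyMeasurable_indicator_iff hΩ.measurableSet]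
    exact hcont.aestronglyMeasurable hΩ.measurableSet
  have hint : Integrable r volume := by
    refine ⟨hmeas, ?_⟩
    rw [hasFiniteIntegral_iff_ofReal (Eventually.of_forall hnonneg), ← setLIntegral_univ,
      ← withDensity_apply _ MeasurableSet.univ, ← hν]
    exact measure_lt_top _ _
  have hcdf : ∀ u, cdf ν u = ∫ s in Set.Iic u, r s := fun u => by
    rw [cdf_eq_real, measureReal_def, integral_eq_lintegral_of_nonneg_ae
      (Eventually.of_forall hnonneg) hmeas.restrict, hν, withDensity_apply _ measurableSet_Iic]
  have hsplit : (cdf ν : ℝ → ℝ) = fun u => cdf ν t + ∫ s in t..u, r s := by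
    funext u
    rw [← intervalIntegral.integral_Iic_sub_Iic hint.integrableOn hint.integrableOn, hcdf, hcdf]
    ring
  rw [hsplit]
  exact (intervalIntegral.integral_hasDerivAt_right hint.intervalIntegrable
    (hcont.stronglyMeasurableAtFilter hΩ t ht)
    (hcont.continuousAt (hΩ.mem_nhds ht))).const_add _

/-- A product of one function of the coordinate `j` and functions of the other coordinates
integrates to the product of the integrals. -/
lemma integral_pi_mul_prod_erase {ι : Type*} [Fintype ι] [DecidableEq ι] (ν : ι → Measure ℝ)
    [∀ i, IsProbabilityMeasure (ν i)] (j : ι) (φ : ℝ → ℝ) (h : ι → ℝ → ℝ) :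
    ∫ x, φ (x j) * ∏ i ∈ univ.erase j, h i (x i) ∂(Measure.pi ν)
      = (∫ t, φ t ∂(ν j)) * ∏ i ∈ univ.erase j, ∫ t, h i t ∂(ν i) := by
  have key := integral_fintype_prod_eq_prod (μ := ν) (Function.update h j φ)
  have herase : ∀ i ∈ univ.erase j, Function.update h j φ i = h i := fun i hi =>
    Function.update_of_ne (ne_of_mem_erase hi) _ _
  simp_rw [← mul_prod_erase univ _ (mem_univ j), Function.update_self] at key
  rw [prod_congr rfl fun i hi => by rw [herase i hi]] at key
  rw [← key]
  refine integral_congr_ae (Eventually.of_forall fun x => ?_)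
  exact congrArg (φ (x j) * ·) (prod_congr rfl fun i hi => by rw [herase i hi])

end Lemmas

theorem product_cdf_total_index_proxy
    {d : ℕ} (hd : 0 < d)
    (μ : Fin d → Measure ℝ) [∀ j, IsProbabilityMeasure (μ j)]
    (Ω : Fin d → Set ℝ) (hΩopen : ∀ j, IsOpen (Ω j))
    (ρ F : Fin d → ℝ → ℝ)
    (hdens : ∀ j, μ j = volume.withDensity fun t => ENNReal.ofReal (ρ j t))
    (hρcont : ∀ j, ContinuousOn (ρ j) (Ω j))
    (hρpos : ∀ j, ∀ t ∈ Ω j, 0 < ρ j t)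
    (hρzero : ∀ j, ∀ t ∉ Ω j, ρ j t = 0)
    (hFdef : ∀ j t, F j t = ((μ j) (Set.Iic t)).toReal)
    (a b : Fin d → ℝ) (g : Fin d → ℝ → ℝ)
    (hg : ∀ j t, g j t = a j * F j t + b j)
    (f : (Fin d → ℝ) → ℝ) (hf : ∀ x, f x = ∏ j, g j (x j))
    (Df : Fin d → (Fin d → ℝ) → ℝ)
    (hDf : ∀ (j : Fin d) (x : Fin d → ℝ), (∀ k, x k ∈ Ω k) →
      HasDerivAt (fun t => f (Function.update x j t)) (Df j x) (x j)) :
    ∀ j : Fin d,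
      (∫ x, ((∫ t, (f (Function.update x j t)) ^ 2 ∂(μ j))
          - (∫ t, f (Function.update x j t) ∂(μ j)) ^ 2) ∂(Measure.pi μ))
        = (a j) ^ 2 / 12 * ∏ i ∈ Finset.univ.erase j, ∫ t, (g i t) ^ 2 ∂(μ i)
      ∧ ((1 : ℝ) / 2) * (∫ x, (Df j x) ^ 2 *
            (F j (x j) * (1 - F j (x j)) / (ρ j (x j)) ^ 2) ∂(Measure.pi μ))
        = ∫ x, ((∫ t, (f (Function.update x j t)) ^ 2 ∂(μ j))
            - (∫ t, f (Function.update x j t) ∂(μ j)) ^ 2) ∂(Measure.pi μ) := by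
  have hν : ∀ j, NullSingletonClass (μ j) := fun j => by rw [hdens j]; infer_instance
  have hF : ∀ j t, F j t = ProbabilityTheory.cdf (μ j) t := fun j t => by
    rw [hFdef, ProbabilityTheory.cdf_eq_real, measureReal_def]
  intro j
  have hupd : ∀ x t, f (Function.update x j t)
      = (∏ i ∈ univ.erase j, g i (x i)) * g j t := fun x t => by
    rw [hf, ← mul_prod_erase univ _ (mem_univ j), Function.update_self, mul_comm]
    congr 1
    exact prod_congr rfl fun i hi => by rw [Function.update_of_ne (ne_of_mem_erase hi)]
  have htot : (∫ x, ((∫ t, (f (Function.update x j t)) ^ 2 ∂(μ j))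
        - (∫ t, f (Function.update x j t) ∂(μ j)) ^ 2) ∂(Measure.pi μ))
      = (a j) ^ 2 / 12 * ∏ i ∈ univ.erase j, ∫ t, (g i t) ^ 2 ∂(μ i) := by
    have hvar : ∀ x : Fin d → ℝ, (∫ t, (f (Function.update x j t)) ^ 2 ∂(μ j))
        - (∫ t, f (Function.update x j t) ∂(μ j)) ^ 2
        = (a j) ^ 2 / 12 * ∏ i ∈ univ.erase j, (g i (x i)) ^ 2 := fun x => by
      simp_rw [hupd, mul_pow, integral_const_mul, hg j, hF j, integral_affine_cdf_sq,
        integral_affine_cdf, prod_pow]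
      ring
    simp_rw [hvar]
    rw [integral_pi_mul_prod_erase μ j (fun _ => (a j) ^ 2 / 12) fun i t => (g i t) ^ 2]
    simp
  refine ⟨htot, ?_⟩
  rw [htot]
  have hsupp : ∀ᵐ x ∂(Measure.pi μ), ∀ k, x k ∈ Ω k := by
    refine ae_all_iff.2 fun k => (measurePreserving_eval μ k).quasiMeasurePreserving.ae ?_
    rw [ae_iff, ← Set.compl_def, hdens k, withDensity_apply _ (hΩopen k).measurableSet.compl]
    refine (setLIntegral_congr_fun (hΩopen k).measurableSet.compl fun t ht => ?_).trans
      lintegral_zero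
    simp [hρzero k t ht]
  have hDf_eq : ∀ x : Fin d → ℝ, (∀ k, x k ∈ Ω k) →
      Df j x = (∏ i ∈ univ.erase j, g i (x i)) * (a j * ρ j (x j)) := fun x hx => by
    refine (hDf j x hx).unique ?_
    simp_rw [hupd, hg j, hF j]
    exact (((hasDerivAt_cdf_of_density (hΩopen j) (hdens j) (hρcont j) (hρpos j) (hρzero j)
      (hx j)).const_mul (a j)).add_const _).const_mul _
  have hint : (∫ x, (Df j x) ^ 2 *
        (F j (x j) * (1 - F j (x j)) / (ρ j (x j)) ^ 2) ∂(Measure.pi μ))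
      = ∫ x, (a j) ^ 2 * (F j (x j) * (1 - F j (x j))) *
          ∏ i ∈ univ.erase j, (g i (x i)) ^ 2 ∂(Measure.pi μ) := by
    refine integral_congr_ae ?_
    filter_upwards [hsupp] with x hx
    have hρ := (hρpos j _ (hx j)).ne'
    rw [hDf_eq x hx, prod_pow]
    field_simp
  rw [hint, integral_pi_mul_prod_erase μ j (fun t => (a j) ^ 2 * (F j t * (1 - F j t)))
    fun i t => (g i t) ^ 2]
  simp_rw [hF j, integral_const_mul, integral_cdf_mul_one_sub]
  ring

end
end
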